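/- Fix C ≥ 1. Let Σ ⊆ ℝ³ be a nonempty compact set, let B ⊆ ℝ³ be a closed set, and let f : ℝ³ → ℝ be continuous with f(x) ≥ 0 for all x ∈ Σ. Suppose p ∈ Σ and r₀ > 0 satisfy: the open ball B_{r₀}(p) is disjoint from B, and sup { f(x) : x ∈ Σ ∩ closedBall(p, r₀/2) } ≥ 16 C² r₀^{−2}. Then there exist a point q ∈ Σ ∩ B_{r₀}(p) and a scale s > 0 such that f(q) = s^{−2}, the open ball B_{Cs}(q) is contained in B_{r₀}(p) (in particular B_{Cs}(q) ∩ B = ∅), and sup { f(x) : x ∈ Σ ∩ B_{Cs}(q) } ≤ 4 s^{−2}. -/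

import Mathlib

open Real Set Metric

/-- Point selection: existence of `C` blow-up pairs. If `f ≥ 0` is continuous on the nonempty
compact set `S`, the ball `B_{r₀}(p)` misses the closed set `B`, and the sup of `f` over
`S ∩ closedBall(p, r₀/2)` is at least `16 C² r₀⁻²`, then there is `q ∈ S ∩ B_{r₀}(p)` and
`s > 0` with `f q = s⁻²`, `B_{Cs}(q) ⊆ B_{r₀}(p)` (so `B_{Cs}(q) ∩ B = ∅`) and
`f ≤ 4 s⁻²` on `S ∩ B_{Cs}(q)`. -/
theorem blow_up_pair_exists (C : ℝ) (hC : 1 ≤ C)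
    (S : Set (EuclideanSpace ℝ (Fin 3))) (hSne : S.Nonempty) (hSc : IsCompact S)
    (B : Set (EuclideanSpace ℝ (Fin 3))) (hB : IsClosed B)
    (f : EuclideanSpace ℝ (Fin 3) → ℝ) (hf : Continuous f) (hf0 : ∀ x ∈ S, 0 ≤ f x)
    (p : EuclideanSpace ℝ (Fin 3)) (hp : p ∈ S) (r₀ : ℝ) (hr₀ : 0 < r₀)
    (hball : ball p r₀ ∩ B = ∅)
    (hsup : 16 * C ^ 2 / r₀ ^ 2 ≤ sSup (f '' (S ∩ closedBall p (r₀ / 2)))) :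
    ∃ q ∈ S ∩ ball p r₀, ∃ s : ℝ, 0 < s ∧ f q = 1 / s ^ 2 ∧
      ball q (C * s) ⊆ ball p r₀ ∧ ball q (C * s) ∩ B = ∅ ∧
      ∀ x ∈ S ∩ ball q (C * s), f x ≤ 4 / s ^ 2 := by
  have hC0 : 0 < C := by linarith
  have hK1 : IsCompact (S ∩ closedBall p (r₀ / 2)) := hSc.inter_right isClosed_closedBall
  have hne1 : (S ∩ closedBall p (r₀ / 2)).Nonempty :=
    ⟨p, hp, mem_closedBall_self (by linarith)⟩
  obtain ⟨y, ⟨hyS, hyb⟩, hy, -⟩ := hK1.exists_sSup_image_eq_and_ge hne1 hf.continuousOn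
  rw [hy] at hsup
  rw [mem_closedBall] at hyb
  have hK2 : IsCompact (S ∩ closedBall p r₀) := hSc.inter_right isClosed_closedBall
  have hcont : Continuous (fun x => f x * (r₀ - dist x p) ^ 2) := by fun_prop
  obtain ⟨q, ⟨hqS, hqb⟩, hq⟩ := hK2.exists_isMaxOn
    ⟨p, hp, mem_closedBall_self hr₀.le⟩ hcont.continuousOn
  have hq' : ∀ x ∈ S, dist x p ≤ r₀ →
      f x * (r₀ - dist x p) ^ 2 ≤ f q * (r₀ - dist q p) ^ 2 :=
    fun x hx hxb => hq ⟨hx, mem_closedBall.2 hxb⟩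
  rw [mem_closedBall] at hqb
  have h1 : 4 * C ^ 2 ≤ f q * (r₀ - dist q p) ^ 2 := by
    refine le_trans ?_ (hq' y hyS (by linarith))
    calc 4 * C ^ 2 = 16 * C ^ 2 / r₀ ^ 2 * (r₀ / 2) ^ 2 := by field_simp; norm_num
      _ ≤ f y * (r₀ - dist y p) ^ 2 := by
        have := hf0 y hyS
        gcongr
        linarith
  set d := r₀ - dist q p with hd
  have hd0 : 0 ≤ d := by linarith
  have hpos : 0 < f q * d ^ 2 := lt_of_lt_of_le (by positivity) h1
  have hdpos : 0 < d := by
    rcases hd0.eq_or_lt with h | h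
    · rw [← h] at hpos; norm_num at hpos
    · exact h
  have hfq : 0 < f q := by
    rcases (hf0 q hqS).eq_or_lt with h | h
    · rw [← h] at hpos; norm_num at hpos
    · exact h
  have hsq : √(f q) ^ 2 = f q := Real.sq_sqrt hfq.le
  have hs0 : 0 < √(f q) := Real.sqrt_pos.2 hfq
  have hCs : C * (1 / √(f q)) ≤ d / 2 := by
    have : 2 * C ≤ √(f q) * d := by
      refine (sq_le_sq₀ (by positivity) (by positivity)).1 ?_
      rw [mul_pow, mul_pow, hsq]; linarith
    rw [mul_one_div, div_le_iff₀ hs0]; linarith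
  have hx : ∀ x ∈ ball q (C * (1 / √(f q))), d / 2 < r₀ - dist x p := by
    intro x hx
    rw [mem_ball] at hx
    have := dist_triangle x q p
    linarith
  have hsub : ball q (C * (1 / √(f q))) ⊆ ball p r₀ := by
    intro x h
    have := hx x h
    rw [mem_ball]; linarith
  refine ⟨q, ⟨hqS, by rw [mem_ball]; linarith⟩, 1 / √(f q), by positivity, ?_, hsub, ?_, ?_⟩
  · rw [div_pow, hsq]; simp
  · exact subset_empty_iff.1 (hball ▸ inter_subset_inter_left B hsub)
  · rintro x ⟨hxS, hxb⟩
    have h2 := hx x hxb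
    have h3 := hq' x hxS (by linarith)
    have h4 : f x * (d / 2) ^ 2 ≤ f q * d ^ 2 := by
      refine le_trans ?_ h3
      have := hf0 x hxS
      gcongr
    have h5 : 4 / (1 / √(f q)) ^ 2 = 4 * f q := by rw [div_pow, hsq]; simp
    rw [h5]
    have : f x * d ^ 2 ≤ (4 * f q) * d ^ 2 := by nlinarith
    exact le_of_mul_le_mul_right this (by positivity)
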